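/- arXiv:1505.07123 — 3 statements merged into one kernel-verified Lean document; each statement's English description precedes it below -/
import Mathlib

section
/- Let (E, 𝓛, ℬ) be a weakly left resolving labelled space over alphabet 𝒜 with associated inverse semigroup S, and let ξ^α be a filter in E(S) of finite type (α ∈ 𝓛*(E)). Then ξ^α is an ultrafilter in E(S) if and only if ξ_{|α|} is an ultrafilter in ℬ_α and for each letter b ∈ 𝒜 there exists A ∈ ξ_{|α|} such that r(A, b) = ∅. -/
universe u v w

attribute [local instance] Classical.propDecidable

/-- Elements of the semigroups `T` and `S` associated with a labelled space:
`none` plays the role of the zero element, and `some (α, A, β)` is a triple. -/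
abbrev STrip (V : Type u) (L : Type w) := List L × Set V × List L

/-- A labelled graph: a directed graph `(V, Ed, rng, src)` together with a labelling
map `lbl` on edges, over the alphabet `L`. -/
structure LabelledGraph (V : Type u) (Ed : Type v) (L : Type w) where
  src : Ed → V
  rng : Ed → V
  lbl : Ed → L

namespace LabelledGraph

variable {V : Type u} {Ed : Type v} {L : Type w} (G : LabelledGraph V Ed L)

/-- A (finite) path: a list of edges with matching ranges and sources. -/
def IsPath (p : List Ed) : Prop := p.Chain' (fun e f => G.rng e = G.src f)

/-- `α ∈ 𝓛*(E)`: the labels of finite paths, together with the empty word `[]`. -/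
def IsWord (α : List L) : Prop := ∃ p : List Ed, G.IsPath p ∧ p.map G.lbl = α

/-- The relative range `r(A, α)`, with `r(A, ω) = A` for the empty word. -/
def relRange (A : Set V) : List L → Set V
  | [] => A
  | a :: w =>
      {v | ∃ (p : List Ed) (h : p ≠ []), G.IsPath p ∧ p.map G.lbl = a :: w ∧
        G.src (p.head h) ∈ A ∧ G.rng (p.getLast h) = v}

/-- `r(α) = r(E⁰, α)`. -/
def range (α : List L) : Set V := G.relRange Set.univ α

/-- `ℬ_α = ℬ ∩ 𝒫(r(α))`. -/
def rFam (ℬ : Set (Set V)) (α : List L) : Set (Set V) := {A ∈ ℬ | A ⊆ G.range α}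

/-- `ℬ` is accommodating for the labelled graph `G`: closed under relative ranges,
finite intersections and unions, and contains `r(α)` for every nonempty word `α`. -/
def Accommodating (ℬ : Set (Set V)) : Prop :=
  (∀ A ∈ ℬ, ∀ α : List L, G.IsWord α → G.relRange A α ∈ ℬ) ∧
  (∀ A ∈ ℬ, ∀ B ∈ ℬ, A ∩ B ∈ ℬ) ∧
  (∀ A ∈ ℬ, ∀ B ∈ ℬ, A ∪ B ∈ ℬ) ∧
  (∀ α : List L, α ≠ [] → G.IsWord α → G.range α ∈ ℬ)

/-- The labelled space `(G, ℬ)` is weakly left resolving. -/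
def WeaklyLeftResolving (ℬ : Set (Set V)) : Prop :=
  ∀ A ∈ ℬ, ∀ B ∈ ℬ, ∀ α : List L, α ≠ [] →
    G.relRange (A ∩ B) α = G.relRange A α ∩ G.relRange B α

/-- `ℬ` is closed under relative complements. -/
def ClosedUnderRelComp (ℬ : Set (Set V)) : Prop :=
  ∀ A ∈ ℬ, ∀ B ∈ ℬ, A \ B ∈ ℬ

/-- Membership in the semigroup `T`: either the zero `none`, or a triple `(α, A, β)`
with `α, β ∈ 𝓛*(E)` and `A ∈ ℬ_α ∩ ℬ_β`. -/
def ValidT (ℬ : Set (Set V)) (t : Option (STrip V L)) : Prop :=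
  ∀ x ∈ t, G.IsWord x.1 ∧ G.IsWord x.2.2 ∧ x.2.1 ∈ G.rFam ℬ x.1 ∧ x.2.1 ∈ G.rFam ℬ x.2.2

/-- Membership in the inverse semigroup `S`: as in `T`, but triples with empty middle
set are identified with the zero, so nonzero elements have nonempty middle set. -/
def ValidS (ℬ : Set (Set V)) (t : Option (STrip V L)) : Prop :=
  G.ValidT ℬ t ∧ ∀ x ∈ t, x.2.1 ≠ (∅ : Set V)

/-- The product on `T`. -/
noncomputable def mulT : Option (STrip V L) → Option (STrip V L) → Option (STrip V L)
  | some (α, A, β), some (γ, B, δ) =>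
      if β <+: γ then
        some (α ++ γ.drop β.length, G.relRange A (γ.drop β.length) ∩ B, δ)
      else if γ <+: β then
        some (α, A ∩ G.relRange B (β.drop γ.length), δ ++ β.drop γ.length)
      else none
  | _, _ => none

/-- The product on `S`: the product of `T`, with triples having empty middle set
collapsed to the zero element. -/
noncomputable def mulS (s t : Option (STrip V L)) : Option (STrip V L) :=
  match G.mulT s t with
  | none => none
  | some (α, A, β) => if A = (∅ : Set V) then none else some (α, A, β)

/-- A nonzero idempotent `(α, A, α)` of `S`, represented as the pair `(α, A)`. -/
def ValidE (ℬ : Set (Set V)) (p : List L × Set V) : Prop :=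
  G.IsWord p.1 ∧ p.2 ∈ G.rFam ℬ p.1 ∧ p.2 ≠ (∅ : Set V)

/-- The natural order on nonzero idempotents of `S`:
`(α, A, α) ≤ (β, B, β)` iff `α = βγ` and `A ⊆ r(B, γ)`. -/
def esLe (p q : List L × Set V) : Prop :=
  ∃ γ : List L, p.1 = q.1 ++ γ ∧ p.2 ⊆ G.relRange q.2 γ

/-- `p ∧ q ≠ 0` for nonzero idempotents `p`, `q` of `S`. -/
def meetNeZero (p q : List L × Set V) : Prop :=
  (∃ γ : List L, q.1 = p.1 ++ γ ∧ (G.relRange p.2 γ ∩ q.2).Nonempty) ∨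
  (∃ γ : List L, p.1 = q.1 ++ γ ∧ (p.2 ∩ G.relRange q.2 γ).Nonempty)

/-- A filter in the semilattice `E(S)`, identified with its set of (nonzero) elements:
nonempty, not containing `0`, upward closed and downward directed. -/
def IsFilterES (ℬ : Set (Set V)) (ξ : Set (List L × Set V)) : Prop :=
  ξ.Nonempty ∧ (∀ p ∈ ξ, G.ValidE ℬ p) ∧
  (∀ p ∈ ξ, ∀ q, G.ValidE ℬ q → G.esLe p q → q ∈ ξ) ∧
  (∀ p ∈ ξ, ∀ q ∈ ξ, ∃ z ∈ ξ, G.esLe z p ∧ G.esLe z q)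

/-- An ultrafilter in `E(S)`: a filter not properly contained in any filter. -/
def IsUltraES (ℬ : Set (Set V)) (ξ : Set (List L × Set V)) : Prop :=
  G.IsFilterES ℬ ξ ∧ ∀ η, G.IsFilterES ℬ η → ξ ⊆ η → ξ = η

/-- `Z` is a cover for `x` in `E(S)`: `Z ⊆ ↓x` and every nonzero `y ≤ x` meets some
element of `Z` nontrivially. -/
def IsCover (ℬ : Set (Set V)) (Z : Set (List L × Set V)) (x : List L × Set V) : Prop :=
  (∀ z ∈ Z, G.ValidE ℬ z ∧ G.esLe z x) ∧
  ∀ y, G.ValidE ℬ y → G.esLe y x → ∃ z ∈ Z, G.meetNeZero z y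

/-- A tight filter in `E(S)`: a filter meeting every finite cover of each of its
elements. -/
def IsTight (ℬ : Set (Set V)) (ξ : Set (List L × Set V)) : Prop :=
  G.IsFilterES ℬ ξ ∧
  ∀ x ∈ ξ, ∀ Z : Set (List L × Set V), Z.Finite → G.IsCover ℬ Z x → (Z ∩ ξ).Nonempty

/-- A filter in a family `𝒞` of subsets of `V` (e.g. `ℬ_α`), ordered by inclusion
with least element `∅`. -/
def IsFilterIn (𝒞 F : Set (Set V)) : Prop :=
  F.Nonempty ∧ F ⊆ 𝒞 ∧ (∅ : Set V) ∉ F ∧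
  (∀ A ∈ F, ∀ B ∈ 𝒞, A ⊆ B → B ∈ F) ∧
  (∀ A ∈ F, ∀ B ∈ F, ∃ C ∈ F, C ⊆ A ∧ C ⊆ B)

/-- An ultrafilter in a family `𝒞` of subsets of `V`. -/
def IsUltraIn (𝒞 F : Set (Set V)) : Prop :=
  IsFilterIn 𝒞 F ∧ ∀ F', IsFilterIn 𝒞 F' → F ⊆ F' → F = F'

/-- `α ∈ 𝓛^∞(E)`: labels of infinite paths. -/
def IsInfWord (α : ℕ → L) : Prop :=
  ∃ p : ℕ → Ed, (∀ n, G.rng (p n) = G.src (p (n + 1))) ∧ ∀ n, G.lbl (p n) = α n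

end LabelledGraph

/-- `α_{n+1, m}` (in the 1-indexed notation of the paper): the finite subword of the
infinite word `α` consisting of its letters at (0-indexed) positions `n, …, m-1`. -/
def LabelledGraph.seg {L : Type w} (α : ℕ → L) (n m : ℕ) : List L :=
  (List.range (m - n)).map fun i => α (n + i)

/-- `α_{1, n}`: the first `n` letters of the infinite word `α`. -/
def LabelledGraph.prefixN {L : Type w} (α : ℕ → L) (n : ℕ) : List L :=
  LabelledGraph.seg α 0 n

namespace LabelledGraph

variable {V : Type u} {Ed : Type v} {L : Type w} (G : LabelledGraph V Ed L)

/-- A family `{F n}` as in the paper: `F n` is a filter in `ℬ_{α_{1,n}}` for `n > 0`,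
and `F 0` is a filter in `ℬ` or empty. -/
def IsFam (ℬ : Set (Set V)) (α : ℕ → L) (F : ℕ → Set (Set V)) : Prop :=
  (∀ n, 0 < n → IsFilterIn (G.rFam ℬ (prefixN α n)) (F n)) ∧
  (F 0 = ∅ ∨ IsFilterIn (G.rFam ℬ (prefixN α 0)) (F 0))

/-- An admissible family for the infinite word `α`. -/
def Admissible (ℬ : Set (Set V)) (α : ℕ → L) (F : ℕ → Set (Set V)) : Prop :=
  G.IsFam ℬ α F ∧
  ∀ n, F n ⊆ {A ∈ G.rFam ℬ (prefixN α n) | G.relRange A [α n] ∈ F (n + 1)}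

/-- A complete family for the infinite word `α`. -/
def Complete (ℬ : Set (Set V)) (α : ℕ → L) (F : ℕ → Set (Set V)) : Prop :=
  G.IsFam ℬ α F ∧
  ∀ n, F n = {A ∈ G.rFam ℬ (prefixN α n) | G.relRange A [α n] ∈ F (n + 1)}

/-- The subset `⋃_{n} ⋃_{A ∈ F n} ↑(α_{1,n}, A, α_{1,n})` of `E(S)` determined by an
infinite word `α` and a family `{F n}`. -/
def filtOfFam (ℬ : Set (Set V)) (α : ℕ → L) (F : ℕ → Set (Set V)) :
    Set (List L × Set V) :=
  {q | G.ValidE ℬ q ∧ ∃ n, ∃ A ∈ F n, G.esLe (prefixN α n, A) q}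

/-- The prefix `α_{1,n}` of a finite-or-infinite word. -/
def wTake : List L ⊕ (ℕ → L) → ℕ → List L
  | Sum.inl w, n => w.take n
  | Sum.inr α, n => prefixN α n

/-- `n ≤ |α|` for a finite-or-infinite word `α`. -/
def wLe (n : ℕ) : List L ⊕ (ℕ → L) → Prop
  | Sum.inl w => n ≤ w.length
  | Sum.inr _ => True

/-- The finite-or-infinite word is a labelled path (`𝓛*(E) ∪ 𝓛^∞(E)`). -/
def wGood : List L ⊕ (ℕ → L) → Prop
  | Sum.inl w => G.IsWord w
  | Sum.inr α => G.IsInfWord α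

/-- `α` is a beginning of (or equal to) `β`, for finite-or-infinite words. -/
def wBeg : List L ⊕ (ℕ → L) → List L ⊕ (ℕ → L) → Prop
  | Sum.inl a, Sum.inl b => a <+: b
  | Sum.inl a, Sum.inr β => a = prefixN β a.length
  | Sum.inr α, Sum.inr β => α = β
  | Sum.inr _, Sum.inl _ => False

/-- The word associated with a filter `ξ` in `E(S)`: for a finite word `w`, `w`
appears in `ξ` and has the largest length; for an infinite word `α`, the words of
elements of `ξ` are beginnings of `α`, of unbounded length. -/
def HasWord (ξ : Set (List L × Set V)) : List L ⊕ (ℕ → L) → Prop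
  | Sum.inl w => (∃ A, (w, A) ∈ ξ) ∧ ∀ p ∈ ξ, p.1.length ≤ w.length
  | Sum.inr α => (∀ p ∈ ξ, ∃ n, p.1 = prefixN α n) ∧ ∀ n, ∃ p ∈ ξ, n ≤ p.1.length

end LabelledGraph
namespace LabelledGraph

theorem relRange_mono' {V : Type u} {Ed : Type v} {L : Type w} (G : LabelledGraph V Ed L)
    {A B : Set V} (h : A ⊆ B) (γ : List L) : G.relRange A γ ⊆ G.relRange B γ := by
  cases γ with
  | nil => exact h
  | cons a t =>
    rintro v ⟨p, hp, h1, h2, h3, h4⟩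
    exact ⟨p, hp, h1, h2, h h3, h4⟩

theorem relRange_comp' {V : Type u} {Ed : Type v} {L : Type w} (G : LabelledGraph V Ed L)
    (A : Set V) (γ δ : List L) :
    G.relRange (G.relRange A γ) δ ⊆ G.relRange A (γ ++ δ) := by
  cases γ with
  | nil => exact subset_rfl
  | cons a t =>
    cases δ with
    | nil => simp [relRange]
    | cons b t2 =>
      rintro v ⟨p, hp, h1, h2, ⟨p', hp', h1', h2', h3', h4'⟩, h4⟩
      refine ⟨p' ++ p, by simp [hp], ?_, by simp [h2, h2'], ?_, ?_⟩
      · unfold IsPath at *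
        refine List.IsChain.append h1' h1 ?_
        intro x hx y hy
        rw [List.getLast?_eq_getLast_of_ne_nil hp'] at hx
        rw [List.head?_eq_some_head hp] at hy
        simp only [Option.mem_def, Option.some.injEq] at hx hy
        rw [← hx, ← hy, h4']
      · rw [List.head_append_of_ne_nil hp']; exact h3'
      · rw [List.getLast_append_of_ne_nil _ hp]; exact h4

theorem isWord_of_relRange' {V : Type u} {Ed : Type v} {L : Type w} (G : LabelledGraph V Ed L)
    {A : Set V} {γ : List L} (hne : γ ≠ []) (h : (G.relRange A γ).Nonempty) : G.IsWord γ := by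
  cases γ with
  | nil => exact absurd rfl hne
  | cons a t =>
    obtain ⟨v, p, hp, h1, h2, -⟩ := h
    exact ⟨p, h1, h2⟩

theorem relRange_cons_empty' {V : Type u} {Ed : Type v} {L : Type w} (G : LabelledGraph V Ed L)
    {A : Set V} {b : L} (t : List L) (h : G.relRange A [b] = ∅) :
    G.relRange A (b :: t) = ∅ := by
  rw [Set.eq_empty_iff_forall_notMem] at h ⊢
  rintro v ⟨p, hp, h1, h2, h3, h4⟩
  cases p with
  | nil => exact hp rfl
  | cons e q =>
    simp only [List.map_cons, List.cons.injEq] at h2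
    exact h (G.rng e) ⟨[e], by simp, List.IsChain.singleton e, by simp [h2.1], h3, rfl⟩

theorem esLe_trans' {V : Type u} {Ed : Type v} {L : Type w} (G : LabelledGraph V Ed L)
    {p q z : List L × Set V} (h1 : G.esLe p q) (h2 : G.esLe q z) : G.esLe p z := by
  obtain ⟨γ, e1, s1⟩ := h1
  obtain ⟨δ, e2, s2⟩ := h2
  refine ⟨δ ++ γ, by rw [e1, e2, List.append_assoc], s1.trans ?_⟩
  exact (G.relRange_mono' s2 γ).trans (G.relRange_comp' _ _ _)

theorem esLe_same' {V : Type u} {Ed : Type v} {L : Type w} (G : LabelledGraph V Ed L)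
    {α : List L} {A B : Set V} : G.esLe (α, A) (α, B) ↔ A ⊆ B := by
  constructor
  · rintro ⟨γ, e, s⟩
    have : γ = [] := by simpa using e
    subst this
    exact s
  · intro h
    exact ⟨[], by simp, h⟩

/-- If words of `η` below `(α, ·)` are only `α`, then the `α`-section is a filter. -/
theorem section_filter' {V : Type u} {Ed : Type v} {L : Type w} (G : LabelledGraph V Ed L)
    {ℬ : Set (Set V)} {η : Set (List L × Set V)} (hη : G.IsFilterES ℬ η) {α : List L}
    (hα : G.IsWord α) (hA : ∃ A, (α, A) ∈ η) (h : ∀ γ C, (α ++ γ, C) ∈ η → γ = []) :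
    IsFilterIn (G.rFam ℬ α) {A : Set V | (α, A) ∈ η} := by
  obtain ⟨-, hv, hu, hd⟩ := hη
  refine ⟨hA, fun A h => (hv _ h).2.1, fun h => (hv _ h).2.2 rfl, ?_, ?_⟩
  · intro A hA B hB hAB
    refine hu _ hA (α, B) ⟨hα, hB, ?_⟩ (G.esLe_same'.2 hAB)
    rintro rfl
    exact (hv _ hA).2.2 (Set.subset_empty_iff.1 hAB)
  · intro A hA B hB
    obtain ⟨⟨w, C⟩, hz, h1, h2⟩ := hd _ hA _ hB
    obtain ⟨γ, e, -⟩ := id h1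
    simp only at e
    subst e
    have := h _ _ hz
    subst this
    simp only [List.append_nil] at hz h1 h2
    exact ⟨C, hz, G.esLe_same'.1 h1, G.esLe_same'.1 h2⟩

/-- The upward closure of a directed family of valid elements is a filter. -/
theorem upfilter' {V : Type u} {Ed : Type v} {L : Type w} (G : LabelledGraph V Ed L)
    {ℬ : Set (Set V)} {F : Set (Set V)} (hF : F.Nonempty) (β : List L) (f : Set V → Set V)
    (hv : ∀ A ∈ F, G.ValidE ℬ (β, f A))
    (hd : ∀ A ∈ F, ∀ B ∈ F, ∃ C ∈ F, f C ⊆ f A ∧ f C ⊆ f B) :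
    G.IsFilterES ℬ {q | G.ValidE ℬ q ∧ ∃ A ∈ F, G.esLe (β, f A) q} := by
  obtain ⟨A, hA⟩ := hF
  refine ⟨⟨(β, f A), hv A hA, A, hA, G.esLe_same'.2 subset_rfl⟩, fun p h => h.1, ?_, ?_⟩
  · rintro p ⟨-, A, hA, h⟩ q hq hpq
    exact ⟨hq, A, hA, G.esLe_trans' h hpq⟩
  · rintro p ⟨-, A, hA, h⟩ q ⟨-, B, hB, hle⟩
    obtain ⟨C, hC, h1, h2⟩ := hd A hA B hB
    exact ⟨(β, f C), ⟨hv C hC, C, hC, G.esLe_same'.2 subset_rfl⟩,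
      G.esLe_trans' (G.esLe_same'.2 h1) h, G.esLe_trans' (G.esLe_same'.2 h2) hle⟩

/-- A filter `ξ = ξ^α` in `E(S)` of finite type (with word
`α ∈ 𝓛*(E)`) is an ultrafilter iff `ξ_{|α|}` is an ultrafilter in `ℬ_α` and for
each letter `b` of the alphabet there exists `A ∈ ξ_{|α|}` with `r(A, b) = ∅`. -/
theorem ultrafilter_finite_type_iff {V : Type u} {Ed : Type v} {L : Type w}
    [Nonempty V] [Countable V] [Nonempty Ed] [Countable Ed]
    (G : LabelledGraph V Ed L) (ℬ : Set (Set V))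
    (hacc : G.Accommodating ℬ) (hwlr : G.WeaklyLeftResolving ℬ)
    (ξ : Set (List L × Set V)) (hξ : G.IsFilterES ℬ ξ)
    (α : List L) (hα : G.IsWord α) (hw : HasWord ξ (Sum.inl α)) :
    G.IsUltraES ℬ ξ ↔
      (IsUltraIn (G.rFam ℬ α) {A : Set V | (α, A) ∈ ξ} ∧
        ∀ b : L, ∃ A : Set V, (α, A) ∈ ξ ∧ G.relRange A [b] = (∅ : Set V)) := by
  obtain ⟨⟨A₀, hA₀⟩, hlen⟩ := hw
  have hnil : ∀ γ C, (α ++ γ, C) ∈ ξ → γ = [] := by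
    intro γ C h
    have := hlen _ h
    simp only [List.length_append] at this
    exact List.length_eq_zero_iff.1 (by omega)
  have hF := G.section_filter' hξ hα ⟨A₀, hA₀⟩ hnil
  -- every element of `ξ` is above some `(α, C)` in `ξ`
  have hbelow : ∀ q ∈ ξ, ∃ C, (α, C) ∈ ξ ∧ G.esLe (α, C) q := by
    intro q hq
    obtain ⟨⟨w, C⟩, hz, ⟨γ, e, -⟩, h2⟩ := hξ.2.2.2 _ hA₀ _ hq
    simp only at e
    subst e
    have := hnil _ _ hz
    subst this
    simp only [List.append_nil] at hz h2
    exact ⟨C, hz, h2⟩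
  constructor
  · rintro ⟨-, hmax⟩
    refine ⟨⟨hF, ?_⟩, ?_⟩
    · intro F' hF' hsub
      obtain ⟨hne, hsub', hemp, hup, hdir⟩ := hF'
      have hv : ∀ A ∈ F', G.ValidE ℬ (α, A) := fun A hA =>
        ⟨hα, hsub' hA, fun h => hemp (by simp only at h; rwa [h] at hA)⟩
      have hη := G.upfilter' hne α id hv hdir
      have heq := hmax _ hη (fun q hq => by
        obtain ⟨C, hC, hle⟩ := hbelow q hq
        exact ⟨hξ.2.1 q hq, C, hsub hC, hle⟩)
      refine hsub.antisymm fun A hA => ?_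
      change (α, A) ∈ ξ
      rw [heq]
      exact ⟨hv A hA, A, hA, G.esLe_same'.2 subset_rfl⟩
    · intro b
      by_contra! hb
      have hle : ∀ A, G.esLe (α ++ [b], G.relRange A [b]) (α, A) :=
        fun A => ⟨[b], rfl, subset_rfl⟩
      have hv : ∀ A ∈ {A : Set V | (α, A) ∈ ξ}, G.ValidE ℬ (α ++ [b], G.relRange A [b]) := by
        intro A hA
        have hne : (G.relRange A [b]).Nonempty := Set.nonempty_iff_ne_empty.2 (by simpa [Set.nonempty_iff_ne_empty] using hb A hA)
        have hsub : G.relRange A [b] ⊆ G.range (α ++ [b]) :=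
          (G.relRange_mono' (hξ.2.1 _ hA).2.1.2 [b]).trans (G.relRange_comp' _ _ _)
        exact ⟨G.isWord_of_relRange' (by simp) (hne.mono hsub),
          ⟨hacc.1 A (hξ.2.1 _ hA).2.1.1 [b] (G.isWord_of_relRange' (by simp) hne), hsub⟩,
          hne.ne_empty⟩
      have hη := G.upfilter' (F := {A : Set V | (α, A) ∈ ξ}) ⟨A₀, hA₀⟩ (α ++ [b])
        (fun A => G.relRange A [b]) hv (fun A hA B hB => by
          obtain ⟨C, hC, h1, h2⟩ := hF.2.2.2.2 A hA B hB
          exact ⟨C, hC, G.relRange_mono' h1 _, G.relRange_mono' h2 _⟩)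
      have heq := hmax _ hη (fun q hq => by
        obtain ⟨C, hC, h⟩ := hbelow q hq
        exact ⟨hξ.2.1 q hq, C, hC, G.esLe_trans' (hle C) h⟩)
      have hmem : (α ++ [b], G.relRange A₀ [b]) ∈ ξ := by
        rw [heq]
        exact ⟨hv A₀ hA₀, A₀, hA₀, G.esLe_same'.2 subset_rfl⟩
      simpa using hnil _ _ hmem
  · rintro ⟨⟨-, hmax⟩, hb⟩
    refine ⟨hξ, fun η hη hsub => hsub.antisymm fun p hp => ?_⟩
    have hnil' : ∀ γ C, (α ++ γ, C) ∈ η → γ = [] := by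
      intro γ C h
      cases γ with
      | nil => rfl
      | cons b t =>
        exfalso
        obtain ⟨A, hA, hAb⟩ := hb b
        obtain ⟨⟨w, D⟩, hz, ⟨δ, e, -⟩, ⟨δ', e', s⟩⟩ := hη.2.2.2 _ h _ (hsub hA)
        simp only at e e' s
        rw [e, List.append_assoc] at e'
        have := List.append_cancel_left e'
        rw [← this, List.cons_append, G.relRange_cons_empty' _ hAb] at s
        exact (hη.2.1 _ hz).2.2 (Set.subset_empty_iff.1 s)
    have heq := hmax _ (G.section_filter' hη hα ⟨A₀, hsub hA₀⟩ hnil') (fun A hA => hsub hA)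
    obtain ⟨⟨w, C⟩, hz, ⟨γ, e, -⟩, h2⟩ := hη.2.2.2 _ (hsub hA₀) _ hp
    simp only at e
    subst e
    have := hnil' _ _ hz
    subst this
    simp only [List.append_nil] at hz h2
    have hC : C ∈ {A : Set V | (α, A) ∈ ξ} := by
      rw [heq]; exact hz
    exact hξ.2.2.1 _ hC p (hη.2.1 p hp) h2

end LabelledGraph
end

section
/- Let (E, 𝓛, ℬ) be a weakly left resolving labelled space such that ℬ is closed under relative complements, with associated inverse semigroup S, and let ξ^α be a filter in E(S) of infinite type (α ∈ 𝓛^∞(E)) with associated family {ξ_n}_{n≥0}. Then ξ^α is an ultrafilter in E(S) if and only if ξ_n is an ultrafilter in ℬ_{α_{1,n}} for every n > 0 and ξ_0 is either an ultrafilter in ℬ or the empty set. -/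
universe u v w

attribute [local instance] Classical.propDecidable

namespace LabelledGraph

section Helpers
variable {V : Type u} {Ed : Type v} {L : Type w} (G : LabelledGraph V Ed L)

/-- One-letter step. -/
def stepH (A : Set V) (a : L) : Set V := {v | ∃ e, G.lbl e = a ∧ G.src e ∈ A ∧ G.rng e = v}

theorem relRange_consH (A : Set V) (a : L) (w : List L) :
    G.relRange A (a :: w) = G.relRange (G.stepH A a) w := by
  cases w with
  | nil =>
    ext v
    constructor
    · rintro ⟨p, h, hp, hm, hs, hr⟩
      match p, h with
      | [e], _ => exact ⟨e, by simpa using hm, hs, hr⟩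
      | e :: f :: t, _ => simp at hm
    · rintro ⟨e, h1, h2, h3⟩
      exact ⟨[e], by simp, List.isChain_singleton _, by simp [h1], h2, h3⟩
  | cons b w =>
    ext v
    constructor
    · rintro ⟨p, h, hp, hm, hs, hr⟩
      match p, h with
      | [e], _ => simp at hm
      | e :: f :: t, _ =>
        replace hp := List.isChain_cons_cons.1 hp
        simp only [List.map_cons, List.cons.injEq] at hm
        refine ⟨f :: t, by simp, hp.2, by simp [hm], ⟨e, hm.1, hs, hp.1⟩, ?_⟩
        simpa using hr
    · rintro ⟨p, h, hp, hm, ⟨e, h1, h2, h3⟩, hr⟩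
      match p, h with
      | f :: t, _ =>
        refine ⟨e :: f :: t, by simp, ?_, ?_, h2, ?_⟩
        · exact List.isChain_cons_cons.2 ⟨h3, hp⟩
        · simp only [List.map_cons] at hm ⊢
          rw [hm, h1]
        · simpa using hr

theorem relRange_appendH (A : Set V) (β γ : List L) :
    G.relRange A (β ++ γ) = G.relRange (G.relRange A β) γ := by
  induction β generalizing A with
  | nil => rfl
  | cons a w ih => rw [List.cons_append, relRange_consH, ih, relRange_consH]

theorem relRange_monoH {A B : Set V} (h : A ⊆ B) (γ : List L) :
    G.relRange A γ ⊆ G.relRange B γ := by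
  cases γ with
  | nil => exact h
  | cons a w =>
    rintro v ⟨p, h1, h2, h3, h4, h5⟩
    exact ⟨p, h1, h2, h3, h h4, h5⟩

theorem relRange_unionH (A B : Set V) (γ : List L) :
    G.relRange (A ∪ B) γ ⊆ G.relRange A γ ∪ G.relRange B γ := by
  cases γ with
  | nil => exact subset_rfl
  | cons a w =>
    rintro v ⟨p, h1, h2, h3, h4, h5⟩
    rcases h4 with h4 | h4
    · exact Or.inl ⟨p, h1, h2, h3, h4, h5⟩
    · exact Or.inr ⟨p, h1, h2, h3, h4, h5⟩

theorem relRange_emptyH (γ : List L) : G.relRange (∅ : Set V) γ = ∅ := by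
  cases γ with
  | nil => rfl
  | cons a w =>
    ext v
    constructor
    · rintro ⟨p, h1, h2, h3, h4, h5⟩
      exact h4
    · intro h
      exact h.elim

theorem relRange_interH {ℬ : Set (Set V)} (hwlr : G.WeaklyLeftResolving ℬ) {A B : Set V}
    (hA : A ∈ ℬ) (hB : B ∈ ℬ) (γ : List L) :
    G.relRange (A ∩ B) γ = G.relRange A γ ∩ G.relRange B γ := by
  cases γ with
  | nil => rfl
  | cons a w => exact hwlr A hA B hB _ (by simp)

theorem isWord_appendH {β γ : List L} (h : G.IsWord (β ++ γ)) : G.IsWord β ∧ G.IsWord γ := by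
  obtain ⟨p, hp, hm⟩ := h
  obtain ⟨p1, p2, rfl, h1, h2⟩ := List.map_eq_append_iff.1 hm
  exact ⟨⟨p1, (List.isChain_append.1 hp).1, h1⟩, ⟨p2, (List.isChain_append.1 hp).2.1, h2⟩⟩

theorem esLe_transH {p q r : List L × Set V} (h1 : G.esLe p q) (h2 : G.esLe q r) :
    G.esLe p r := by
  obtain ⟨γ, e, s⟩ := h1
  obtain ⟨δ, e', s'⟩ := h2
  refine ⟨δ ++ γ, by rw [e, e', List.append_assoc], ?_⟩
  rw [relRange_appendH]
  exact s.trans (G.relRange_monoH s' γ)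

/-- If an element of a filter lies below `(w, A)` then `A` is in the slice. -/
theorem mem_of_leH {ℬ : Set (Set V)} {ξ : Set (List L × Set V)} (hξ : G.IsFilterES ℬ ξ)
    {p : List L × Set V} (hp : p ∈ ξ) {w γ : List L} {A : Set V} (hA : A ∈ G.rFam ℬ w)
    (e : p.1 = w ++ γ) (hs : p.2 ⊆ G.relRange A γ) : (w, A) ∈ ξ := by
  have hv := hξ.2.1 p hp
  refine hξ.2.2.1 p hp _ ⟨?_, hA, ?_⟩ ⟨γ, e, hs⟩
  · have := hv.1
    rw [e] at this
    exact (G.isWord_appendH this).1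
  · rintro h
    dsimp only at h
    subst h
    rw [relRange_emptyH] at hs
    exact hv.2.2 (Set.subset_empty_iff.1 hs)

theorem slice_filterH {ℬ : Set (Set V)} (hacc : G.Accommodating ℬ)
    (hwlr : G.WeaklyLeftResolving ℬ) {ξ : Set (List L × Set V)} (hξ : G.IsFilterES ℬ ξ)
    {w : List L} {D : Set V} (hD : (w, D) ∈ ξ) :
    IsFilterIn (G.rFam ℬ w) {A : Set V | (w, A) ∈ ξ} := by
  refine ⟨⟨D, hD⟩, fun A hA => (hξ.2.1 _ hA).2.1, fun h => (hξ.2.1 _ h).2.2 rfl, ?_, ?_⟩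
  · intro A hA B hB hAB
    exact G.mem_of_leH hξ hA (γ := []) hB (by simp) hAB
  · intro A hA B hB
    obtain ⟨z, hz, ⟨γ, e, s⟩, ⟨δ, e', s'⟩⟩ := hξ.2.2.2 _ hA _ hB
    dsimp only at e s e' s'
    have hγ : γ = δ := List.append_cancel_left (e.symm.trans e')
    subst hγ
    have vA := (hξ.2.1 _ hA).2.1
    have vB := (hξ.2.1 _ hB).2.1
    refine ⟨A ∩ B, ?_, Set.inter_subset_left, Set.inter_subset_right⟩
    refine G.mem_of_leH hξ hz ⟨hacc.2.1 _ vA.1 _ vB.1, Set.inter_subset_left.trans vA.2⟩ e ?_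
    rw [G.relRange_interH hwlr vA.1 vB.1]
    exact Set.subset_inter s s'

theorem slice_ultraH {ℬ : Set (Set V)} (hacc : G.Accommodating ℬ)
    (hwlr : G.WeaklyLeftResolving ℬ) (hrc : ClosedUnderRelComp ℬ)
    {ξ : Set (List L × Set V)} (hU : G.IsUltraES ℬ ξ)
    {w : List L} {D : Set V} (hD : (w, D) ∈ ξ) :
    IsUltraIn (G.rFam ℬ w) {A : Set V | (w, A) ∈ ξ} := by
  have hξ := hU.1
  refine ⟨G.slice_filterH hacc hwlr hξ hD, fun F hF hsub => hsub.antisymm ?_⟩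
  intro A hA
  have vA := hF.2.1 hA
  have vD := (hξ.2.1 _ hD).2.1
  have hwd := (hξ.2.1 _ hD).1
  by_cases H : ∀ p ∈ ξ, ∀ γ, p.1 = w ++ γ → (p.2 ∩ G.relRange A γ).Nonempty
  · let η : Set (List L × Set V) := {q | G.ValidE ℬ q ∧ ∃ p ∈ ξ, ∃ γ, p.1 = w ++ γ ∧
      G.esLe (p.1, p.2 ∩ G.relRange A γ) q}
    have hsubη : ξ ⊆ η := by
      intro q hq
      obtain ⟨z, hz, ⟨γ, e, s⟩, ⟨δ, e', s'⟩⟩ := hξ.2.2.2 _ hq _ hD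
      exact ⟨hξ.2.1 _ hq, z, hz, δ, e', γ, e, Set.inter_subset_left.trans s⟩
    have hη : G.IsFilterES ℬ η := by
      refine ⟨⟨_, hsubη hD⟩, fun p hp => hp.1, ?_, ?_⟩
      · rintro p ⟨_, p', hp', γ, e, hle⟩ q hq hpq
        exact ⟨hq, p', hp', γ, e, G.esLe_transH hle hpq⟩
      · rintro q1 ⟨hv1, p1, hp1, γ1, e1, le1⟩ q2 ⟨hv2, p2, hp2, γ2, e2, le2⟩
        obtain ⟨z, hz, ⟨δ1, f1, s1⟩, ⟨δ2, f2, s2⟩⟩ := hξ.2.2.2 _ hp1 _ hp2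
        have vz := hξ.2.1 _ hz
        have g1 : z.1 = w ++ (γ1 ++ δ1) := by rw [f1, e1, List.append_assoc]
        have g2 : z.1 = w ++ (γ2 ++ δ2) := by rw [f2, e2, List.append_assoc]
        have hc : γ1 ++ δ1 = γ2 ++ δ2 := List.append_cancel_left (g1.symm.trans g2)
        have hword : G.IsWord (γ1 ++ δ1) := by
          have := vz.1
          rw [g1] at this
          exact (G.isWord_appendH this).2
        have key : ∀ (p : List L × Set V) (γ δ : List L), p ∈ ξ → γ1 ++ δ1 = γ ++ δ →
            z.1 = p.1 ++ δ → z.2 ⊆ G.relRange p.2 δ →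
            G.esLe (z.1, z.2 ∩ G.relRange A (γ1 ++ δ1)) (p.1, p.2 ∩ G.relRange A γ) := by
          intro p γ δ hp hγδ f s
          refine ⟨δ, f, ?_⟩
          dsimp only
          rw [hγδ] at hword ⊢
          rw [G.relRange_interH hwlr (hξ.2.1 _ hp).2.1.1
            (hacc.1 _ vA.1 _ (G.isWord_appendH hword).1), relRange_appendH]
          exact Set.inter_subset_inter_left _ s
        refine ⟨(z.1, z.2 ∩ G.relRange A (γ1 ++ δ1)), ⟨⟨vz.1, ⟨?_, ?_⟩, ?_⟩, z, hz, _, g1, ?_⟩,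
          G.esLe_transH (key p1 γ1 δ1 hp1 rfl f1 s1) le1,
          G.esLe_transH (key p2 γ2 δ2 hp2 hc f2 s2) le2⟩
        · exact hacc.2.1 _ vz.2.1.1 _ (hacc.1 _ vA.1 _ hword)
        · exact Set.inter_subset_left.trans vz.2.1.2
        · exact (H z hz _ g1).ne_empty
        · exact ⟨[], by simp, subset_rfl⟩
    have hmem : (w, A) ∈ η := by
      refine ⟨⟨hwd, vA, fun h => hF.2.2.1 ?_⟩, (w, D), hD, [], by simp, [], by simp,
        Set.inter_subset_right⟩
      dsimp only at h
      rwa [h] at hA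
    rw [← hU.2 η hη hsubη] at hmem
    exact hmem
  · exfalso
    push Not at H
    obtain ⟨p, hp, γ, e, hemp⟩ := H
    have vp := hξ.2.1 _ hp
    have hwγ : G.IsWord γ := by
      have := vp.1
      rw [e] at this
      exact (G.isWord_appendH this).2
    obtain ⟨z, hz, ⟨δ, f, s⟩, ⟨ε, f', s'⟩⟩ := hξ.2.2.2 _ hp _ hD
    dsimp only at f' s'
    have hε : ε = γ ++ δ := by
      apply List.append_cancel_left (as := w)
      rw [← f', f, e, List.append_assoc]
    subst hε
    have hdiff : (w, D \ A) ∈ ξ := by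
      refine G.mem_of_leH hξ hz ⟨hrc _ vD.1 _ vA.1, Set.sdiff_subset.trans vD.2⟩ f' ?_
      intro v hv
      have h1 := G.relRange_monoH (show D ⊆ A ∪ D \ A by simp) _ (s' hv)
      rcases G.relRange_unionH _ _ _ h1 with h2 | h2
      · exfalso
        rw [relRange_appendH] at h2
        have h3 : v ∈ G.relRange (p.2 ∩ G.relRange A γ) δ := by
          rw [G.relRange_interH hwlr vp.2.1.1 (hacc.1 _ vA.1 _ hwγ)]
          exact ⟨s hv, h2⟩
        rw [hemp, relRange_emptyH] at h3
        exact h3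
      · exact h2
    obtain ⟨C, hC, hCA, hCD⟩ := hF.2.2.2.2 _ hA _ (hsub hdiff)
    have : C = ∅ := by
      ext v
      constructor
      · intro hv
        exact ((hCD hv).2 (hCA hv)).elim
      · intro hv
        exact hv.elim
    exact hF.2.2.1 (this ▸ hC)

theorem length_prefixNH (α : ℕ → L) (n : ℕ) : (prefixN α n).length = n := by
  simp [prefixN, seg]

theorem prefix_eqH {α : ℕ → L} {m : ℕ} {w γ : List L} (h : prefixN α m = w ++ γ) :
    w = prefixN α w.length := by
  have hl : w.length ≤ m := by
    have := congrArg List.length h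
    rw [length_prefixNH, List.length_append] at this
    omega
  have h2 : w = (prefixN α m).take w.length := by rw [h]; simp
  rw [h2]
  simp [prefixN, seg, ← List.map_take, List.take_range, hl]

theorem prefixN_splitH (α : ℕ → L) {n m : ℕ} (h : n ≤ m) :
    ∃ γ, prefixN α m = prefixN α n ++ γ := by
  refine ⟨(prefixN α m).drop n, ?_⟩
  conv_lhs => rw [← List.take_append_drop n (prefixN α m)]
  congr 1
  simp [prefixN, seg, ← List.map_take, List.take_range, h]

theorem slice_nonemptyH {ℬ : Set (Set V)} (hacc : G.Accommodating ℬ)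
    {ξ : Set (List L × Set V)} (hξ : G.IsFilterES ℬ ξ)
    {α : ℕ → L} (hw : HasWord ξ (Sum.inr α)) {n : ℕ} (hn : 0 < n) :
    ∃ D, (prefixN α n, D) ∈ ξ := by
  obtain ⟨p, hp, hl⟩ := hw.2 n
  obtain ⟨m, hm⟩ := hw.1 p hp
  rw [hm, length_prefixNH] at hl
  obtain ⟨γ, e⟩ := prefixN_splitH α hl
  have vp := hξ.2.1 _ hp
  have e' := hm.trans e
  have hwd : G.IsWord (prefixN α n) := by
    have := vp.1
    rw [e'] at this
    exact (G.isWord_appendH this).1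
  have hne : prefixN α n ≠ [] := by
    intro h
    have := congrArg List.length h
    rw [length_prefixNH] at this
    simp at this
    omega
  refine ⟨G.range (prefixN α n), G.mem_of_leH hξ hp ⟨hacc.2.2.2 _ hne hwd, subset_rfl⟩ e' ?_⟩
  have := vp.2.1.2
  rw [e', range, relRange_appendH] at this
  exact this

end Helpers


/-- Suppose `ℬ` is moreover closed under relative complements.
A filter `ξ = ξ^α` in `E(S)` of infinite type (word `α ∈ 𝓛^∞(E)`, family `{ξ_n}`)
is an ultrafilter iff `ξ_n` is an ultrafilter in `ℬ_{α_{1,n}}` for every `n > 0`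
and `ξ_0` is either an ultrafilter in `ℬ` or empty. -/
theorem ultrafilter_infinite_type_iff_family_ultra {V : Type u} {Ed : Type v} {L : Type w}
    [Nonempty V] [Countable V] [Nonempty Ed] [Countable Ed]
    (G : LabelledGraph V Ed L) (ℬ : Set (Set V))
    (hacc : G.Accommodating ℬ) (hwlr : G.WeaklyLeftResolving ℬ)
    (hrc : ClosedUnderRelComp ℬ)
    (ξ : Set (List L × Set V)) (hξ : G.IsFilterES ℬ ξ)
    (α : ℕ → L) (hα : G.IsInfWord α) (hw : HasWord ξ (Sum.inr α)) :
    G.IsUltraES ℬ ξ ↔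
      ((∀ n, 0 < n →
          IsUltraIn (G.rFam ℬ (prefixN α n)) {A : Set V | (prefixN α n, A) ∈ ξ}) ∧
        ({A : Set V | (prefixN α 0, A) ∈ ξ} = ∅ ∨
          IsUltraIn (G.rFam ℬ (prefixN α 0)) {A : Set V | (prefixN α 0, A) ∈ ξ})) := by
  constructor
  · intro hU
    refine ⟨fun n hn => ?_, ?_⟩
    · obtain ⟨D, hD⟩ := G.slice_nonemptyH hacc hξ hw hn
      exact G.slice_ultraH hacc hwlr hrc hU hD
    · rcases Set.eq_empty_or_nonempty {A : Set V | (prefixN α 0, A) ∈ ξ} with h | ⟨D, hD⟩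
      · exact Or.inl h
      · exact Or.inr (G.slice_ultraH hacc hwlr hrc hU hD)
  · rintro ⟨h1, h0⟩
    refine ⟨hξ, fun η hη hsub => hsub.antisymm ?_⟩
    have step : ∀ n B, IsUltraIn (G.rFam ℬ (prefixN α n)) {A : Set V | (prefixN α n, A) ∈ ξ} →
        (prefixN α n, B) ∈ η → (prefixN α n, B) ∈ ξ := by
      intro n B hu hB
      have := hu.2 _ (G.slice_filterH hacc hwlr hη hB) (fun A hA => hsub hA)
      have hB' : B ∈ {A : Set V | (prefixN α n, A) ∈ η} := hB
      rw [← this] at hB'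
      exact hB'
    rintro ⟨w, B⟩ hq
    obtain ⟨p, hp, hl⟩ := hw.2 w.length
    obtain ⟨m, hm⟩ := hw.1 p hp
    obtain ⟨z, hz, ⟨γ, e, s⟩, ⟨δ, e', s'⟩⟩ := hη.2.2.2 _ (hsub hp) _ hq
    dsimp only at e' s'
    obtain ⟨ρ, hρ⟩ : w <+: p.1 :=
      List.prefix_of_prefix_length_le ⟨δ, e'.symm⟩ ⟨γ, e.symm⟩ hl
    have hwp : w = prefixN α w.length := prefix_eqH (hm.symm.trans hρ.symm)
    rcases Nat.eq_zero_or_pos w.length with hz0 | hpos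
    · have hw0 : w = [] := List.length_eq_zero_iff.1 hz0
      subst hw0
      rcases h0 with h0 | h0
      · obtain ⟨D, hD⟩ := G.slice_nonemptyH hacc hξ hw Nat.one_pos
        obtain ⟨y, hy, ⟨a, ea, sa⟩, ⟨b, eb, sb⟩⟩ := hη.2.2.2 _ (hsub hD) _ hq
        dsimp only at ea sa eb sb
        have hb : b = prefixN α 1 ++ a := by
          rw [← ea, eb]; rfl
        subst hb
        rw [relRange_appendH] at sb
        have hm1 : (prefixN α 1, G.relRange B (prefixN α 1)) ∈ η :=
          G.mem_of_leH hη hy ⟨hacc.1 _ (hη.2.1 _ hq).2.1.1 _ (hξ.2.1 _ hD).1,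
            G.relRange_monoH (Set.subset_univ _) _⟩ ea sb
        exact G.mem_of_leH hξ (step 1 _ (h1 1 Nat.one_pos) hm1) (hη.2.1 _ hq).2.1 rfl subset_rfl
      · exact step 0 B h0 hq
    · rw [hwp] at hq ⊢
      exact step _ B (h1 _ hpos) hq

end LabelledGraph
end

section
/- Let (E, 𝓛, ℬ) be a weakly left resolving labelled space such that ℬ is closed under relative complements, with associated inverse semigroup S, and let ξ^α be a tight filter in E(S) with associated family {ξ_n}_{0≤n≤|α|}. Then for every 0 < n ≤ |α|, ξ_n is an ultrafilter in ℬ_{α_{1,n}}, and ξ_0 is either an ultrafilter in ℬ or the empty set. -/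
universe u v w

attribute [local instance] Classical.propDecidable

namespace LabelledGraph

section Helpers

variable {V : Type u} {Ed : Type v} {L : Type w}

theorem aux_relRange_union (G : LabelledGraph V Ed L) (A B : Set V) (γ : List L) :
    G.relRange (A ∪ B) γ = G.relRange A γ ∪ G.relRange B γ := by
  cases γ with
  | nil => rfl
  | cons a t =>
    ext v
    constructor
    · rintro ⟨p, h, hp, hm, hs | hs, hr⟩
      · exact Or.inl ⟨p, h, hp, hm, hs, hr⟩
      · exact Or.inr ⟨p, h, hp, hm, hs, hr⟩
    · rintro (⟨p, h, hp, hm, hs, hr⟩ | ⟨p, h, hp, hm, hs, hr⟩)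
      · exact ⟨p, h, hp, hm, Or.inl hs, hr⟩
      · exact ⟨p, h, hp, hm, Or.inr hs, hr⟩

theorem aux_relRange_nonempty (G : LabelledGraph V Ed L) (A : Set V) (γ : List L)
    (h : (G.relRange A γ).Nonempty) : A.Nonempty := by
  cases γ with
  | nil => exact h
  | cons a t =>
    obtain ⟨v, p, h, hp, hm, hs, hr⟩ := h
    exact ⟨_, hs⟩

theorem aux_isWord_prefix (G : LabelledGraph V Ed L) (β γ : List L)
    (h : G.IsWord (β ++ γ)) : G.IsWord β := by
  obtain ⟨p, hp, hm⟩ := h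
  obtain ⟨p1, p2, rfl, h1, h2⟩ := List.map_eq_append_iff.1 hm
  exact ⟨p1, List.IsChain.left_of_append hp, h1⟩

theorem aux_range_nonempty (G : LabelledGraph V Ed L) (β γ : List L) (hβ : β ≠ [])
    (h : (G.range (β ++ γ)).Nonempty) : (G.range β).Nonempty := by
  cases β with
  | nil => exact absurd rfl hβ
  | cons a t =>
    obtain ⟨v, p, h, hp, hm, hs, hr⟩ := h
    change p.map G.lbl = (a :: t) ++ γ at hm
    obtain ⟨p1, p2, rfl, h1, h2⟩ := List.map_eq_append_iff.1 hm
    have hne : p1 ≠ [] := by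
      rintro rfl
      simp at h1
    exact ⟨_, p1, hne, List.IsChain.left_of_append hp, h1, trivial, rfl⟩

theorem aux_range_sub (G : LabelledGraph V Ed L) (β γ : List L) (hβ : β ≠ []) :
    G.range (β ++ γ) ⊆ G.relRange (G.range β) γ := by
  cases γ with
  | nil => simp [relRange]
  | cons c s =>
    cases β with
    | nil => exact absurd rfl hβ
    | cons a t =>
      rintro v ⟨p, h, hp, hm, hs, hr⟩
      change p.map G.lbl = (a :: t) ++ (c :: s) at hm
      obtain ⟨p1, p2, rfl, h1, h2⟩ := List.map_eq_append_iff.1 hm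
      have hne : p1 ≠ [] := by
        rintro rfl
        simp at h1
      have hne2 : p2 ≠ [] := by
        rintro rfl
        simp at h2
      refine ⟨p2, hne2, List.IsChain.right_of_append hp, h2,
        ⟨p1, hne, List.IsChain.left_of_append hp, h1, trivial, ?_⟩, ?_⟩
      · have := (List.isChain_append.1 hp).2.2
        exact this _ (List.getLast_mem_getLast? hne) _ (List.head_mem_head? hne2)
      · rw [← hr, List.getLast_append_of_ne_nil _ hne2]

theorem aux_ultra (G : LabelledGraph V Ed L) (ℬ : Set (Set V))
    (hacc : G.Accommodating ℬ) (hwlr : G.WeaklyLeftResolving ℬ)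
    (hrc : ClosedUnderRelComp ℬ)
    (ξ : Set (List L × Set V)) (htight : G.IsTight ℬ ξ) (β : List L)
    (hne : {A : Set V | (β, A) ∈ ξ}.Nonempty) :
    IsUltraIn (G.rFam ℬ β) {A : Set V | (β, A) ∈ ξ} := by
  obtain ⟨⟨-, hval, hup, hdir⟩, ht⟩ := htight
  have hβ : G.IsWord β := by
    obtain ⟨A, hA⟩ := hne
    exact (hval _ hA).1
  have hmono : ∀ A, (β, A) ∈ ξ → ∀ B ∈ G.rFam ℬ β, A ⊆ B → (β, B) ∈ ξ := by
    intro A hA B hB hAB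
    have hA' : A ≠ ∅ := (hval _ hA).2.2
    refine hup _ hA _ ⟨hβ, hB, ?_⟩ ⟨[], by simp, hAB⟩
    rintro rfl
    exact hA' (Set.subset_empty_iff.1 hAB)
  refine ⟨⟨hne, fun A hA => (hval _ hA).2.1, fun h => (hval _ h).2.2 rfl, hmono, ?_⟩, ?_⟩
  · intro A hA B hB
    obtain ⟨z, hz, ⟨γ, h1, h2⟩, ⟨γ', h3, h4⟩⟩ := hdir _ hA _ hB
    simp only at h1 h2 h3 h4
    have hγ : γ = γ' := List.append_cancel_left (h1.symm.trans h3)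
    subst hγ
    have hAB : A ∩ B ∈ ℬ := hacc.2.1 _ (hval _ hA).2.1.1 _ (hval _ hB).2.1.1
    have hsub : z.2 ⊆ G.relRange (A ∩ B) γ := by
      by_cases hg : γ = []
      · subst hg
        exact Set.subset_inter h2 h4
      · rw [hwlr A (hval _ hA).2.1.1 B (hval _ hB).2.1.1 γ hg]
        exact Set.subset_inter h2 h4
    refine ⟨A ∩ B, ?_, Set.inter_subset_left, Set.inter_subset_right⟩
    refine hup z hz _ ⟨hβ, ⟨hAB, fun v hv => (hval _ hA).2.1.2 hv.1⟩, ?_⟩ ⟨γ, h1, hsub⟩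
    exact (aux_relRange_nonempty G _ γ
      ((Set.nonempty_iff_ne_empty.2 (hval _ hz).2.2).mono hsub)).ne_empty
  · intro F' hF' hsub
    obtain ⟨-, hF1, hF0, -, hFd⟩ := hF'
    refine Set.Subset.antisymm hsub ?_
    intro B hB
    by_contra hBn
    obtain ⟨A, hA⟩ := hne
    have hA' : (β, A) ∈ ξ := hA
    have hmeet : ∀ C ∈ F', ∀ D ∈ F', (C ∩ D).Nonempty := by
      intro C hC D hD
      obtain ⟨K, hK, h1, h2⟩ := hFd C hC D hD
      have : K.Nonempty := by
        rw [Set.nonempty_iff_ne_empty]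
        rintro rfl
        exact hF0 hK
      exact this.mono (Set.subset_inter h1 h2)
    have hAr := (hval _ hA').2.1
    have hBr := hF1 hB
    have hI : G.ValidE ℬ (β, A ∩ B) :=
      ⟨hβ, ⟨hacc.2.1 _ hAr.1 _ hBr.1, fun v hv => hAr.2 hv.1⟩,
        (hmeet A (hsub hA) B hB).ne_empty⟩
    have hD : G.ValidE ℬ (β, A \ B) := by
      refine ⟨hβ, ⟨hrc _ hAr.1 _ hBr.1, fun v hv => hAr.2 hv.1⟩, ?_⟩
      intro h
      exact hBn (hmono A hA B hBr (Set.diff_eq_empty.1 h))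
    obtain ⟨z, hzZ, hz⟩ := ht _ hA' {(β, A ∩ B), (β, A \ B)} (by simp) (by
      refine ⟨?_, ?_⟩
      · rintro z (rfl | rfl)
        · exact ⟨hI, [], by simp, fun v hv => hv.1⟩
        · exact ⟨hD, [], by simp, fun v hv => hv.1⟩
      · rintro ⟨y1, y2⟩ hy ⟨γ, h1, h2⟩
        simp only at h1 h2
        obtain ⟨v, hv⟩ := Set.nonempty_iff_ne_empty.2 hy.2.2
        have hv2 := h2 hv
        rw [← Set.inter_union_sdiff A B, aux_relRange_union] at hv2
        rcases hv2 with hv2 | hv2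
        · exact ⟨_, Or.inl rfl, Or.inl ⟨γ, h1, v, hv2, hv⟩⟩
        · exact ⟨_, Or.inr rfl, Or.inl ⟨γ, h1, v, hv2, hv⟩⟩)
    rcases hzZ with rfl | rfl
    · exact hBn (hmono _ hz B hBr Set.inter_subset_right)
    · obtain ⟨v, hv⟩ := hmeet _ (hsub hz) B hB
      exact hv.1.2 hv.2

theorem aux_wTake (ξ : Set (List L × Set V)) (w : List L ⊕ (ℕ → L)) (hw : HasWord ξ w)
    (n : ℕ) (hn : wLe n w) :
    (wTake w n).length = n ∧ ∃ p ∈ ξ, ∃ γ, p.1 = wTake w n ++ γ := by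
  cases w with
  | inl w =>
    obtain ⟨⟨A, hA⟩, -⟩ := hw
    have hn' : n ≤ w.length := hn
    exact ⟨by simp [wTake, hn'], _, hA, w.drop n, by simp [wTake]⟩
  | inr α =>
    obtain ⟨h1, h2⟩ := hw
    refine ⟨by simp [wTake, prefixN, seg], ?_⟩
    obtain ⟨p, hp, hl⟩ := h2 n
    obtain ⟨m, hm⟩ := h1 p hp
    refine ⟨p, hp, p.1.drop n, ?_⟩
    have hnm : n ≤ m := by
      rw [hm] at hl
      simpa [prefixN, seg] using hl
    have : wTake (Sum.inr α) n = p.1.take n := by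
      rw [hm]
      simp [wTake, prefixN, seg, ← List.map_take, List.take_range, hnm]
    rw [this, List.take_append_drop]

end Helpers

end LabelledGraph

namespace LabelledGraph

/-- Suppose `ℬ` is moreover closed under relative complements, and
let `ξ = ξ^α` be a tight filter in `E(S)` with associated family `{ξ_n}`. Then `ξ_n`
is an ultrafilter in `ℬ_{α_{1,n}}` for every `0 < n ≤ |α|`, and `ξ_0` is either an
ultrafilter in `ℬ` or empty. -/
theorem tight_filter_family_ultra {V : Type u} {Ed : Type v} {L : Type w}
    [Nonempty V] [Countable V] [Nonempty Ed] [Countable Ed]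
    (G : LabelledGraph V Ed L) (ℬ : Set (Set V))
    (hacc : G.Accommodating ℬ) (hwlr : G.WeaklyLeftResolving ℬ)
    (hrc : ClosedUnderRelComp ℬ)
    (ξ : Set (List L × Set V)) (htight : G.IsTight ℬ ξ)
    (w : List L ⊕ (ℕ → L)) (hgw : G.wGood w) (hw : HasWord ξ w) :
    (∀ n, 0 < n → wLe n w →
      IsUltraIn (G.rFam ℬ (wTake w n)) {A : Set V | (wTake w n, A) ∈ ξ}) ∧
    ({A : Set V | (wTake w 0, A) ∈ ξ} = ∅ ∨
      IsUltraIn (G.rFam ℬ (wTake w 0)) {A : Set V | (wTake w 0, A) ∈ ξ}) := by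
  refine ⟨?_, ?_⟩
  · intro n hn hle
    apply aux_ultra G ℬ hacc hwlr hrc ξ htight
    obtain ⟨hlen, p, hp, γ, hγ⟩ := aux_wTake ξ w hw n hle
    have hne : wTake w n ≠ [] := by
      intro h
      rw [h] at hlen
      simp at hlen
      omega
    obtain ⟨hpw, hpr, hp0⟩ := htight.1.2.1 p hp
    rw [hγ] at hpw
    have hwd := aux_isWord_prefix G _ _ hpw
    have hsub : p.2 ⊆ G.range (wTake w n ++ γ) := hγ ▸ hpr.2
    refine ⟨G.range (wTake w n), htight.1.2.2.1 p hp _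
      ⟨hwd, ⟨hacc.2.2.2 _ hne hwd, subset_rfl⟩, ?_⟩
      ⟨γ, hγ, hsub.trans (aux_range_sub G _ _ hne)⟩⟩
    exact (aux_range_nonempty G _ γ hne
      ((Set.nonempty_iff_ne_empty.2 hp0).mono hsub)).ne_empty
  · rcases Set.eq_empty_or_nonempty {A : Set V | (wTake w 0, A) ∈ ξ} with h | h
    · exact Or.inl h
    · exact Or.inr (aux_ultra G ℬ hacc hwlr hrc ξ htight _ h)

end LabelledGraph
end
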